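/- Let K be a field, q a nonzero element of K, and x an m×n q-matrix with entries in an associative unital K-algebra A. Let 1 ≤ i < j < k < ℓ ≤ n, let X ⊆ {1,…,n} − {i,j,k,ℓ}, and suppose m ≥ |X| + 2. Then the flag quantum minors satisfy [Xik]·[Xjℓ] = q⁻¹ [Xij]·[Xkℓ] + q [Xiℓ]·[Xjk]. -/

import Mathlib

/-- Number of inversions of a permutation of `Fin k`. -/
def permInversions {k : ℕ} (σ : Equiv.Perm (Fin k)) : ℕ :=
  (Finset.univ.filter (fun p : Fin k × Fin k => p.1 < p.2 ∧ σ p.2 < σ p.1)).card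

/-- The quantum minor `[I|J]_q` of a matrix `x` (indexed by `ℕ`, rows/columns `1,…`),
with row set `I` and column set `J` (both listed in increasing order). -/
noncomputable def qMinor {K : Type} [Field K] {A : Type} [Ring A] [Algebra K A]
    (q : K) (x : ℕ → ℕ → A) (I J : Finset ℕ) : A :=
  if h : I.card = J.card then
    ∑ σ : Equiv.Perm (Fin I.card),
      ((-q) ^ permInversions σ) •
        (List.ofFn (fun d : Fin I.card =>
          x (I.orderEmbOfFin rfl d) (J.orderEmbOfFin h.symm (σ d)))).prod
  else 0

/-- The flag quantum minor `[J]_q := [{1,…,|J|} | J]_q`. -/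
noncomputable def flagMinor {K : Type} [Field K] {A : Type} [Ring A] [Algebra K A]
    (q : K) (x : ℕ → ℕ → A) (J : Finset ℕ) : A :=
  qMinor q x (Finset.Icc 1 J.card) J

/-- Manin's relations: `x` is an `m × n` `q`-matrix. -/
def IsQMatrix {K : Type} [Field K] {A : Type} [Ring A] [Algebra K A]
    (q : K) (m n : ℕ) (x : ℕ → ℕ → A) : Prop :=
  (∀ i j k, 1 ≤ i → i ≤ m → 1 ≤ j → j < k → k ≤ n →
    x i j * x i k = q • (x i k * x i j)) ∧
  (∀ i l j, 1 ≤ i → i < l → l ≤ m → 1 ≤ j → j ≤ n →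
    x i j * x l j = q • (x l j * x i j)) ∧
  (∀ i l j k, 1 ≤ i → i < l → l ≤ m → 1 ≤ j → j < k → k ≤ n →
    x i k * x l j = x l j * x i k) ∧
  (∀ i l j k, 1 ≤ i → i < l → l ≤ m → 1 ≤ j → j < k → k ≤ n →
    x i j * x l k - x l k * x i j = (q - q⁻¹) • (x i k * x l j))

open Finset MulOpposite OrderDual

/-- The sum over all ordered pairs of distinct elements, grouped into unordered pairs. -/
theorem sum_sum_erase_eq_sum_lt {β M : Type} [LinearOrder β] [AddCommMonoid M]
    (J : Finset β) (F : β → β → M) :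
    ∑ c ∈ J, ∑ d ∈ J.erase c, F c d = ∑ c ∈ J, ∑ d ∈ J with c < d, (F c d + F d c) := by
  have h1 : ∀ c ∈ J, ∑ d ∈ J.erase c, F c d =
      ∑ d ∈ J, (if c < d then F c d else 0) + ∑ d ∈ J, (if d < c then F c d else 0) := by
    intro c hc
    rw [← sum_add_distrib, ← add_sum_erase J _ hc]
    simp only [lt_irrefl, if_false, add_zero, zero_add]
    refine sum_congr rfl fun d hd => ?_
    rcases lt_or_gt_of_ne (ne_of_mem_erase hd) with h | h <;> simp [h, h.not_gt]
  rw [sum_congr rfl h1, sum_add_distrib]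
  conv_lhs => rw [add_comm, sum_comm, add_comm, ← sum_add_distrib]
  refine sum_congr rfl fun c _ => ?_
  rw [sum_filter, ← sum_add_distrib]
  refine sum_congr rfl fun d _ => ?_
  split_ifs <;> simp

theorem card_filter_lt_erase_of_lt {β : Type} [LinearOrder β] {J : Finset β} {c d : β}
    (hc : c ∈ J) (h : c < d) :
    #{e ∈ J | e < d} = #{e ∈ J.erase c | e < d} + 1 := by
  rw [filter_erase, card_erase_add_one (by simp [hc, h])]

theorem card_filter_lt_erase_of_le {β : Type} [LinearOrder β] {J : Finset β} {c d : β}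
    (h : c ≤ d) :
    #{e ∈ J.erase d | e < c} = #{e ∈ J | e < c} := by
  rw [filter_erase, erase_eq_of_notMem (by simp [h])]

theorem toFinset_erase_of_nodup {α : Type} [DecidableEq α] {I : List α} (hI : I.Nodup) (a : α) :
    (I.erase a).toFinset = I.toFinset.erase a := by
  ext b
  simp [hI.mem_erase_iff]

/-- Manin's relations for the entries with rows in `S` and columns in `T`. -/
structure ManinOn {K A α β : Type} [Field K] [Ring A] [Algebra K A] [LinearOrder α]
    [LinearOrder β] (q : K) (x : α → β → A) (S : Set α) (T : Set β) : Prop where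
  row : ∀ a ∈ S, ∀ c ∈ T, ∀ d ∈ T, c < d → x a c * x a d = q • (x a d * x a c)
  col : ∀ a ∈ S, ∀ b ∈ S, a < b → ∀ c ∈ T, x a c * x b c = q • (x b c * x a c)
  comm : ∀ a ∈ S, ∀ b ∈ S, a < b → ∀ c ∈ T, ∀ d ∈ T, c < d → x a d * x b c = x b c * x a d
  cross : ∀ a ∈ S, ∀ b ∈ S, a < b → ∀ c ∈ T, ∀ d ∈ T, c < d →
    x a c * x b d - x b d * x a c = (q - q⁻¹) • (x a d * x b c)

/-- The anti-transpose of a matrix, with entries in the opposite algebra. -/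
def antiTranspose {A α β : Type} (x : α → β → A) : βᵒᵈ → αᵒᵈ → Aᵐᵒᵖ :=
  fun c a => op (x (ofDual a) (ofDual c))

/-- The quantum minor with a list of rows, multiplied from left to right, and a set of columns,
defined by Laplace expansion along the first row. -/
def rowMinor {K A α β : Type} [Field K] [Ring A] [Algebra K A] [LinearOrder β]
    (q : K) (x : α → β → A) : List α → Finset β → A
  | [], _ => 1
  | a :: I, J => ∑ c ∈ J, (-q) ^ #{d ∈ J | d < c} • (x a c * rowMinor q x I (J.erase c))

/-- The quantum minor with a set of rows and a list of columns, multiplied from right to left. -/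
def colMinor {K A α β : Type} [Field K] [Ring A] [Algebra K A] [LinearOrder α]
    (q : K) (x : α → β → A) (I : Finset α) (J : List β) : A :=
  unop (rowMinor q (antiTranspose x) (J.map toDual) (I.map toDual.toEmbedding))

section Minors

variable {K A α β : Type} [Field K] [Ring A] [Algebra K A] [LinearOrder α] [LinearOrder β]
  {q : K} {x : α → β → A} {S : Set α} {T : Set β}

theorem ManinOn.antiTranspose (hx : ManinOn q x S T) :
    ManinOn q (antiTranspose x) (ofDual ⁻¹' T) (ofDual ⁻¹' S) where
  row c hc a ha b hb hab := congrArg op (hx.col _ hb _ ha hab _ hc)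
  col c hc d hd hcd a ha := congrArg op (hx.row _ ha _ hd _ hc hcd)
  comm c hc d hd hcd a ha b hb hab := congrArg op (hx.comm _ hb _ ha hab _ hd _ hc hcd).symm
  cross c hc d hd hcd a ha b hb hab := by
    have h := hx.cross _ hb _ ha hab _ hd _ hc hcd
    rw [hx.comm _ hb _ ha hab _ hd _ hc hcd] at h
    exact congrArg op h

omit [LinearOrder α] in
theorem rowMinor_cons (q : K) (x : α → β → A) (a : α) (I : List α) (J : Finset β) :
    rowMinor q x (a :: I) J =
      ∑ c ∈ J, (-q) ^ #{d ∈ J | d < c} • (x a c * rowMinor q x I (J.erase c)) := by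
  rw [rowMinor]

omit [LinearOrder β] in
theorem colMinor_nil (q : K) (x : α → β → A) (I : Finset α) : colMinor q x I [] = 1 := by
  simp [colMinor, rowMinor]

omit [LinearOrder β] in
theorem colMinor_cons (q : K) (x : α → β → A) (I : Finset α) (c : β) (J : List β) :
    colMinor q x I (c :: J) =
      ∑ a ∈ I, (-q) ^ #{b ∈ I | a < b} • (colMinor q x (I.erase a) J * x a c) := by
  simp only [colMinor, List.map_cons, rowMinor_cons, sum_map, unop_sum]
  refine sum_congr rfl fun a _ => ?_
  rw [← map_erase, unop_smul, unop_mul, filter_map, card_map]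
  rfl

omit [LinearOrder α] in
theorem rowMinor_cons_cons (q : K) (x : α → β → A) (a b : α) (I : List α) (J : Finset β) :
    rowMinor q x (a :: b :: I) J = ∑ c ∈ J, ∑ d ∈ J with c < d,
      ((-q) ^ #{e ∈ J | e < c} * (-q) ^ #{e ∈ J.erase c | e < d}) •
        ((x a c * x b d - q • (x a d * x b c)) * rowMinor q x I ((J.erase c).erase d)) := by
  simp only [rowMinor_cons, mul_sum, smul_sum]
  rw [sum_sum_erase_eq_sum_lt]
  refine sum_congr rfl fun c hc => sum_congr rfl fun d hd => ?_
  obtain ⟨hd, hcd⟩ := mem_filter.1 hd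
  rw [card_filter_lt_erase_of_lt hc hcd, card_filter_lt_erase_of_le hcd.le,
    erase_right_comm (a := d)]
  simp only [mul_smul_comm, smul_smul, sub_mul, smul_sub, smul_mul_assoc, ← mul_assoc]
  rw [sub_eq_add_neg, ← neg_smul]
  congr 2
  ring

theorem ManinOn.rowMinor_self_cons (hx : ManinOn q x S T) {a : α} (ha : a ∈ S) (I : List α)
    {J : Finset β} (hJ : ∀ c ∈ J, c ∈ T) : rowMinor q x (a :: a :: I) J = 0 := by
  rw [rowMinor_cons_cons]
  refine sum_eq_zero fun c hc => sum_eq_zero fun d hd => ?_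
  obtain ⟨hd, hcd⟩ := mem_filter.1 hd
  rw [hx.row a ha c (hJ c hc) d (hJ d hd) hcd, sub_self, zero_mul, smul_zero]

theorem ManinOn.rowMinor_swap (hx : ManinOn q x S T) (hq : q ≠ 0) {a b : α} (ha : a ∈ S)
    (hb : b ∈ S) (hab : a < b) (I : List α) {J : Finset β} (hJ : ∀ c ∈ J, c ∈ T) :
    rowMinor q x (b :: a :: I) J = -q • rowMinor q x (a :: b :: I) J := by
  simp only [rowMinor_cons_cons, smul_sum]
  refine sum_congr rfl fun c hc => sum_congr rfl fun d hd => ?_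
  obtain ⟨hd, hcd⟩ := mem_filter.1 hd
  have h1 := hx.comm a ha b hb hab c (hJ c hc) d (hJ d hd) hcd
  have h2 := hx.cross a ha b hb hab c (hJ c hc) d (hJ d hd) hcd
  have h3 : x b c * x a d - q • (x b d * x a c) =
      -q • (x a c * x b d - q • (x a d * x b c)) := by
    rw [← h1, show x b d * x a c = x a c * x b d - (q - q⁻¹) • (x a d * x b c) by
      rw [← h2]; abel]
    match_scalars <;> field_simp
    ring
  rw [h3, smul_mul_assoc, smul_comm]

theorem ManinOn.rowMinor_cons_of_mem (hx : ManinOn q x S T) (hq : q ≠ 0) {a : α} (ha : a ∈ S)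
    {I : List α} (hI : I.Pairwise (· < ·)) (hIS : ∀ b ∈ I, b ∈ S) (haI : a ∈ I)
    {J : Finset β} (hJ : ∀ c ∈ J, c ∈ T) : rowMinor q x (a :: I) J = 0 := by
  induction I generalizing J with
  | nil => simp at haI
  | cons b I ih =>
    rcases List.mem_cons.1 haI with rfl | haI
    · exact hx.rowMinor_self_cons ha I hJ
    · obtain ⟨hb, hI⟩ := List.pairwise_cons.1 hI
      rw [hx.rowMinor_swap hq (hIS b (by simp)) ha (hb a haI) I hJ, rowMinor_cons,
        sum_eq_zero, smul_zero]
      intro c _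
      rw [ih hI (fun d hd => hIS d (by simp [hd])) haI fun d hd => hJ d (mem_of_mem_erase hd),
        mul_zero, smul_zero]

theorem ManinOn.exists_rowMinor_insert (hx : ManinOn q x S T) (hq : q ≠ 0) {a : α} (ha : a ∈ S)
    {I : List α} (hI : I.Pairwise (· < ·)) (hIS : ∀ b ∈ I, b ∈ S) (haI : a ∉ I) :
    ∃ I' : List α, I'.Pairwise (· < ·) ∧ I'.Perm (a :: I) ∧
      ∀ J : Finset β, (∀ c ∈ J, c ∈ T) →
        rowMinor q x (a :: I) J = (-q) ^ (I.countP (· < a)) • rowMinor q x I' J := by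
  induction I with
  | nil => exact ⟨[a], by simp, by simp, by simp⟩
  | cons b I ih =>
    obtain ⟨hb, hI'⟩ := List.pairwise_cons.1 hI
    rw [List.mem_cons, not_or] at haI
    rcases lt_or_gt_of_ne haI.1 with hab | hba
    · refine ⟨a :: b :: I, ?_, by simp, fun J _ => ?_⟩
      · exact List.pairwise_cons.2 ⟨fun c hc => (List.mem_cons.1 hc).elim (fun h => h ▸ hab)
          fun h => hab.trans (hb c h), hI⟩
      · rw [List.countP_eq_zero.2, pow_zero, one_smul]
        intro c hc
        rcases List.mem_cons.1 hc with rfl | h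
        · simpa using hab.le
        · simpa using (hab.trans (hb c h)).le
    · obtain ⟨I', h1, h2, h3⟩ := ih hI' (fun d hd => hIS d (by simp [hd])) haI.2
      refine ⟨b :: I', List.pairwise_cons.2 ⟨fun c hc => ?_, h1⟩,
        (h2.cons b).trans (List.Perm.swap ..), fun J hJ => ?_⟩
      · rcases List.mem_cons.1 (h2.mem_iff.1 hc) with rfl | h
        · exact hba
        · exact hb c h
      · rw [hx.rowMinor_swap hq (hIS b (by simp)) ha hba I hJ, rowMinor_cons q x b I',
          rowMinor_cons, smul_sum, smul_sum]
        refine sum_congr rfl fun c _ => ?_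
        rw [h3 _ fun d hd => hJ d (mem_of_mem_erase hd), List.countP_cons_of_pos (by simpa),
          mul_smul_comm, smul_smul, smul_smul, smul_smul]
        congr 1
        ring

theorem ManinOn.colMinor_cons_of_mem (hx : ManinOn q x S T) (hq : q ≠ 0) {c : β} (hc : c ∈ T)
    {J : List β} (hJ : J.Pairwise (· > ·)) (hJT : ∀ d ∈ J, d ∈ T) (hcJ : c ∈ J)
    {I : Finset α} (hI : ∀ a ∈ I, a ∈ S) : colMinor q x I (c :: J) = 0 := by
  rw [colMinor, List.map_cons, hx.antiTranspose.rowMinor_cons_of_mem hq (a := toDual c)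
    (I := J.map toDual) (by simpa)
    (List.pairwise_map.2 hJ) (by simpa using hJT) (List.mem_map_of_mem hcJ) (by simpa using hI),
    unop_zero]

theorem ManinOn.exists_colMinor_insert (hx : ManinOn q x S T) (hq : q ≠ 0) {c : β} (hc : c ∈ T)
    {J : List β} (hJ : J.Pairwise (· > ·)) (hJT : ∀ d ∈ J, d ∈ T) (hcJ : c ∉ J) :
    ∃ J' : List β, J'.Pairwise (· > ·) ∧ J'.Perm (c :: J) ∧
      ∀ I : Finset α, (∀ a ∈ I, a ∈ S) →
        colMinor q x I (c :: J) = (-q) ^ (J.countP (c < ·)) • colMinor q x I J' := by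
  obtain ⟨J', h1, h2, h3⟩ := hx.antiTranspose.exists_rowMinor_insert hq (a := toDual c)
    (I := J.map toDual) (by simpa) (List.pairwise_map.2 hJ) (by simpa using hJT) (by simpa)
  refine ⟨J'.map ofDual, List.pairwise_map.2 h1, ?_, fun I hI => ?_⟩
  · simpa [Function.comp_def] using h2.map ofDual
  · rw [colMinor, List.map_cons, h3 _ (by simpa using hI), unop_smul, colMinor,
      List.countP_map]
    simp [Function.comp_def]

theorem ManinOn.commute_colMinor (hx : ManinOn q x S T) {a : α} (ha : a ∈ S) {d : β} (hd : d ∈ T)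
    {I : Finset α} (hI : ∀ b ∈ I, b ∈ S ∧ a < b) {J : List β} (hJ : ∀ c ∈ J, c ∈ T ∧ c < d) :
    Commute (x a d) (colMinor q x I J) := by
  induction J generalizing I with
  | nil => rw [colMinor_nil]; exact Commute.one_right _
  | cons c J ih =>
    rw [colMinor_cons]
    refine Commute.sum_right _ _ _ fun b hb => Commute.smul_right (Commute.mul_right ?_ ?_) _
    · exact ih (fun e he => hI e (mem_of_mem_erase he)) fun e he => hJ e (by simp [he])
    · obtain ⟨hc, hcd⟩ := hJ c (by simp)
      exact hx.comm a ha b (hI b hb).1 (hI b hb).2 c hc d hd hcd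

/-- The row and column expansions of a quantum minor agree. -/
theorem ManinOn.rowMinor_eq_colMinor (hx : ManinOn q x S T) {I : List α} {J : List β}
    (hI : I.Pairwise (· < ·)) (hJ : J.Pairwise (· > ·)) (hIS : ∀ a ∈ I, a ∈ S)
    (hJT : ∀ c ∈ J, c ∈ T) (hIJ : I.length = J.length) :
    rowMinor q x I J.toFinset = colMinor q x I.toFinset J := by
  induction hr : I.length using Nat.strong_induction_on generalizing I J with
  | _ r ih =>
  match I, J, hIJ with
  | [], [], _ => simp [rowMinor, colMinor_nil]
  | a :: I, d :: J, hIJ =>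
    obtain ⟨haI, hI⟩ := List.pairwise_cons.1 hI
    obtain ⟨hdJ, hJ⟩ := List.pairwise_cons.1 hJ
    have hIJ : I.length = J.length := by simpa using hIJ
    have haS := hIS a (by simp)
    have hdT := hJT d (by simp)
    have hIS : ∀ b ∈ I, b ∈ S := fun b hb => hIS b (by simp [hb])
    have hJT : ∀ c ∈ J, c ∈ T := fun c hc => hJT c (by simp [hc])
    have hr : r = I.length + 1 := hr.symm
    have haI' : a ∉ I.toFinset := fun h => (haI a (by simpa using h)).false
    have hdJ' : d ∉ J.toFinset := fun h => (hdJ d (by simpa using h)).false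
    have hIn : I.Nodup := hI.imp fun h => h.ne
    have hJn : J.Nodup := hJ.imp fun h => h.ne'
    rw [rowMinor_cons, colMinor_cons, List.toFinset_cons, List.toFinset_cons,
      sum_insert hdJ', sum_insert haI', erase_insert hdJ', erase_insert haI']
    congr 1
    · rw [ih _ (by omega) hI hJ hIS hJT hIJ rfl,
        (hx.commute_colMinor haS hdT (I := I.toFinset) (J := J) (fun b hb =>
          ⟨hIS b (by simpa using hb), haI b (by simpa using hb)⟩)
          fun c hc => ⟨hJT c hc, hdJ c hc⟩).eq,
        filter_insert, if_neg (lt_irrefl _), filter_insert, if_neg (lt_irrefl _),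
        filter_true_of_mem (by simpa using hdJ), filter_true_of_mem (by simpa using haI),
        List.toFinset_card_of_nodup hIn, List.toFinset_card_of_nodup hJn, hIJ]
    · have hR : ∀ c ∈ J.toFinset, rowMinor q x I ((insert d J.toFinset).erase c) =
          ∑ b ∈ I.toFinset, (-q) ^ #{e ∈ I.toFinset | b < e} •
            (colMinor q x (I.toFinset.erase b) (J.erase c) * x b d) := by
        intro c hc
        have hc : c ∈ J := by simpa using hc
        have hl := List.length_erase_add_one hc
        rw [erase_insert_of_ne (hdJ c hc).ne', ← toFinset_erase_of_nodup hJn,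
          ← List.toFinset_cons, ih _ (by omega) hI (List.pairwise_cons.2
            ⟨fun e he => hdJ e (List.mem_of_mem_erase he), hJ.sublist List.erase_sublist⟩) hIS
            (fun e he => (List.mem_cons.1 he).elim (fun h => h ▸ hdT)
              fun h => hJT e (List.mem_of_mem_erase h)) (by simp; omega) rfl, colMinor_cons]
      have hC : ∀ b ∈ I.toFinset, colMinor q x ((insert a I.toFinset).erase b) J =
          ∑ c ∈ J.toFinset, (-q) ^ #{e ∈ J.toFinset | e < c} •
            (x a c * colMinor q x (I.toFinset.erase b) (J.erase c)) := by
        intro b hb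
        have hb : b ∈ I := by simpa using hb
        have hl := List.length_erase_add_one hb
        rw [erase_insert_of_ne (haI b hb).ne, ← toFinset_erase_of_nodup hIn,
          ← List.toFinset_cons, ← ih _ (by simp; omega) (List.pairwise_cons.2
            ⟨fun e he => haI e (List.mem_of_mem_erase he), hI.sublist List.erase_sublist⟩) hJ
            (fun e he => (List.mem_cons.1 he).elim (fun h => h ▸ haS)
              fun h => hIS e (List.mem_of_mem_erase h)) hJT (by simp; omega) rfl, rowMinor_cons]
        refine sum_congr rfl fun c hc => ?_
        have hc : c ∈ J := by simpa using hc
        have hl' := List.length_erase_add_one hc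
        rw [← toFinset_erase_of_nodup hJn, ih _ (by omega) (hI.sublist List.erase_sublist)
          (hJ.sublist List.erase_sublist) (fun e he => hIS e (List.mem_of_mem_erase he))
          (fun e he => hJT e (List.mem_of_mem_erase he)) (by omega) rfl]
      rw [sum_congr rfl fun c hc => congrArg (fun y => _ • (x a c * y)) (hR c hc),
        sum_congr rfl fun b hb => congrArg (fun y => _ • (y * x b d)) (hC b hb)]
      simp only [mul_sum, sum_mul, smul_sum]
      rw [sum_comm]
      refine sum_congr rfl fun b hb => sum_congr rfl fun c hc => ?_
      rw [filter_insert, if_neg (hdJ c (by simpa using hc)).not_gt,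
        filter_insert, if_neg (haI b (by simpa using hb)).not_gt]
      simp only [mul_smul_comm, smul_mul_assoc, mul_assoc]
      rw [smul_comm]

/-- Quantum Plücker relation: exchanging one column between two minors on the same rows. -/
theorem ManinOn.sum_colMinor_mul_rowMinor (hx : ManinOn q x S T) (hq : q ≠ 0) {I : List α}
    (hI : I.Pairwise (· < ·)) (hIS : ∀ a ∈ I, a ∈ S) (M : List β) {L : Finset β}
    (hL : ∀ c ∈ L, c ∈ T) :
    ∑ c ∈ L, (-q) ^ #{d ∈ L | d < c} •
      (colMinor q x I.toFinset (c :: M) * rowMinor q x I (L.erase c)) = 0 := by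
  have h : ∀ a ∈ I.toFinset, (-q) ^ #{b ∈ I.toFinset | a < b} •
      (colMinor q x (I.toFinset.erase a) M * rowMinor q x (a :: I) L) = 0 := by
    intro a ha
    have ha : a ∈ I := by simpa using ha
    rw [hx.rowMinor_cons_of_mem hq (hIS a ha) hI hIS ha hL, mul_zero, smul_zero]
  rw [← sum_eq_zero h]
  simp only [colMinor_cons, rowMinor_cons, sum_mul, mul_sum, smul_sum]
  rw [sum_comm]
  refine sum_congr rfl fun a _ => sum_congr rfl fun c _ => ?_
  simp only [mul_smul_comm, smul_mul_assoc, mul_assoc]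
  rw [smul_comm]

end Minors

section Perm

/-- The permutation of `Fin (k + 1)` sending `0` to `p` and acting as `τ` on the rest. -/
def consPerm {k : ℕ} (p : Fin (k + 1)) (τ : Equiv.Perm (Fin k)) : Equiv.Perm (Fin (k + 1)) :=
  (Equiv.Perm.decomposeFin.symm (0, τ)).trans p.cycleRange.symm

theorem consPerm_zero {k : ℕ} (p : Fin (k + 1)) (τ : Equiv.Perm (Fin k)) :
    consPerm p τ 0 = p := by
  simp [consPerm]

theorem consPerm_succ {k : ℕ} (p : Fin (k + 1)) (τ : Equiv.Perm (Fin k)) (d : Fin k) :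
    consPerm p τ d.succ = p.succAbove (τ d) := by
  simp [consPerm]

theorem consPerm_bijective (k : ℕ) :
    Function.Bijective fun s : Fin (k + 1) × Equiv.Perm (Fin k) => consPerm s.1 s.2 := by
  rw [Fintype.bijective_iff_injective_and_card]
  refine ⟨?_, by simp [Fintype.card_perm, Nat.factorial_succ]⟩
  rintro ⟨p, τ⟩ ⟨p', τ'⟩ h
  have h0 := congrArg (· 0) h
  simp only [consPerm_zero] at h0
  subst h0
  congr 1
  ext d
  have hd := congrArg (· d.succ) h
  simp only [consPerm_succ] at hd
  rw [Fin.succAbove_right_injective hd]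

theorem permInversions_eq_sum {k : ℕ} (σ : Equiv.Perm (Fin k)) :
    permInversions σ = ∑ a, ∑ b, if a < b ∧ σ b < σ a then 1 else 0 := by
  rw [permInversions, card_filter, ← univ_product_univ, sum_product]

theorem card_succAbove_lt {k : ℕ} (p : Fin (k + 1)) :
    #{d : Fin k | p.succAbove d < p} = p := by
  have h : ({d : Fin k | p.succAbove d < p} : Finset (Fin k)).map p.succAboveEmb = Iio p := by
    ext e
    simp only [mem_map, mem_filter, mem_univ, true_and, Fin.coe_succAboveEmb, mem_Iio]
    constructor
    · rintro ⟨d, hd, rfl⟩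
      exact hd
    · intro he
      obtain ⟨d, rfl⟩ := Fin.exists_succAbove_eq he.ne
      exact ⟨d, he, rfl⟩
  rw [← card_map p.succAboveEmb, h, Fin.card_Iio]

theorem permInversions_consPerm {k : ℕ} (p : Fin (k + 1)) (τ : Equiv.Perm (Fin k)) :
    permInversions (consPerm p τ) = p + permInversions τ := by
  rw [permInversions_eq_sum, permInversions_eq_sum, Fin.sum_univ_succ]
  simp only [Fin.sum_univ_succ, consPerm_zero, consPerm_succ, lt_irrefl, false_and, if_false,
    Fin.succ_pos, true_and, Fin.not_lt_zero, zero_add, Fin.succ_lt_succ_iff,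
    Fin.succAbove_lt_succAbove_iff]
  congr 1
  rw [Equiv.sum_comp τ fun d => if p.succAbove d < p then 1 else 0, ← card_filter,
    card_succAbove_lt]

theorem sum_perm_eq_rowMinor {K A : Type} [Field K] [Ring A] [Algebra K A] (q : K)
    (x : ℕ → ℕ → A) {k : ℕ} (f g : Fin k → ℕ) (hg : StrictMono g) :
    ∑ σ : Equiv.Perm (Fin k), (-q) ^ permInversions σ •
      (List.ofFn fun d => x (f d) (g (σ d))).prod =
        rowMinor q x (List.ofFn f) (univ.image g) := by
  induction k with
  | zero => simp [rowMinor, permInversions]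
  | succ k ih =>
    rw [List.ofFn_succ, rowMinor_cons, sum_image hg.injective.injOn,
      ← (consPerm_bijective k).sum_comp, Fintype.sum_prod_type]
    refine sum_congr rfl fun p _ => ?_
    have h1 : (univ.image g).erase (g p) = univ.image (g ∘ p.succAbove) := by
      ext c
      simp only [mem_erase, mem_image, mem_univ, true_and, Function.comp]
      constructor
      · rintro ⟨hc, d, rfl⟩
        obtain ⟨e, rfl⟩ := Fin.exists_succAbove_eq fun h : d = p => hc (congrArg g h)
        exact ⟨e, rfl⟩
      · rintro ⟨e, rfl⟩
        exact ⟨hg.injective.ne (Fin.succAbove_ne p e), _, rfl⟩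
    have h2 : #{d ∈ univ.image g | d < g p} = p := by
      rw [filter_image, card_image_of_injective _ hg.injective]
      simp only [hg.lt_iff_lt]
      rw [← Fin.card_Iio p]
      congr 1
      ext
      simp
    rw [h1, h2, ← ih (fun d => f d.succ) _ (hg.comp p.strictMono_succAbove), mul_sum, smul_sum]
    refine sum_congr rfl fun τ _ => ?_
    simp only [permInversions_consPerm, List.ofFn_succ, List.prod_cons, consPerm_zero,
      consPerm_succ, mul_smul_comm, smul_smul, pow_add, Function.comp]

end Perm

theorem flagMinor_eq_rowMinor {K A : Type} [Field K] [Ring A] [Algebra K A] (q : K)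
    (x : ℕ → ℕ → A) {J : Finset ℕ} {r : ℕ} (hJ : J.card = r) :
    flagMinor q x J = rowMinor q x (List.range' 1 r) J := by
  have hc : (Icc 1 J.card).card = J.card := by simp
  rw [flagMinor, qMinor, dif_pos hc, sum_perm_eq_rowMinor q x _ _ (OrderEmbedding.strictMono _)]
  congr 1
  · refine List.Perm.eq_of_pairwise' (r := (· < ·)) ?_ List.pairwise_lt_range' ?_
    · exact List.pairwise_ofFn.2 fun a b hab => (OrderEmbedding.strictMono _) hab
    · refine (List.perm_ext_iff_of_nodup (List.nodup_ofFn.2 (OrderEmbedding.strictMono _).injective)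
        List.nodup_range').2 fun a => ?_
      rw [List.mem_ofFn, ← Set.mem_range, range_orderEmbOfFin, hJ, coe_Icc, Set.mem_Icc,
        List.mem_range'_1]
      omega
  · exact image_orderEmbOfFin_univ _ _

theorem IsQMatrix.maninOn {K A : Type} [Field K] [Ring A] [Algebra K A] {q : K} {m n : ℕ}
    {x : ℕ → ℕ → A} (hx : IsQMatrix q m n x) :
    ManinOn q x (Set.Icc 1 m) (Set.Icc 1 n) where
  row a ha c hc d hd h := hx.1 a c d ha.1 ha.2 hc.1 h hd.2
  col a ha b hb h c hc := hx.2.1 a b c ha.1 h hb.2 hc.1 hc.2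
  comm a ha b hb h c hc d hd h' := hx.2.2.1 a b c d ha.1 h hb.2 hc.1 h' hd.2
  cross a ha b hb h c hc d hd h' := hx.2.2.2 a b c d ha.1 h hb.2 hc.1 h' hd.2

theorem IsQMatrix.colMinor_cons_eq_flagMinor {K A : Type} [Field K] [Ring A] [Algebra K A] {q : K}
    {m n : ℕ} {x : ℕ → ℕ → A} (hx : IsQMatrix q m n x) (hq : q ≠ 0) {M : Finset ℕ}
    (hM : M ⊆ Icc 1 n) {p : ℕ} (hp : p ∈ Icc 1 n) (hpM : p ∉ M) (hm : #M + 1 ≤ m) :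
    colMinor q x (List.range' 1 (#M + 1)).toFinset (p :: M.sort (· ≥ ·)) =
      (-q) ^ #{d ∈ M | p < d} • flagMinor q x (insert p M) := by
  have hI : ∀ a ∈ List.range' 1 (#M + 1), a ∈ Set.Icc 1 m := by
    intro a ha
    rw [List.mem_range'_1] at ha
    exact ⟨ha.1, by omega⟩
  obtain ⟨J, h1, h2, h3⟩ := hx.maninOn.exists_colMinor_insert hq (c := p) (J := M.sort (· ≥ ·))
    (by simpa using hp) M.sortedGT_sort.pairwise
    (fun d hd => by simpa using hM ((mem_sort _).1 hd)) (by simpa)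
  have hJ : J.toFinset = insert p M := by
    ext d
    simp [h2.mem_iff]
  have hl : J.length = #M + 1 := by simp [h2.length_eq]
  rw [h3 _ (by simpa using hI), ← hx.maninOn.rowMinor_eq_colMinor List.pairwise_lt_range' h1 hI ?_
    (by simp [hl]), hJ, flagMinor_eq_rowMinor q x (card_insert_of_notMem hpM)]
  · congr 2
    rw [List.countP_eq_length_filter, ← List.toFinset_card_of_nodup
      ((M.sort_nodup _).filter _), List.toFinset_filter, sort_toFinset]
    simp
  · intro d hd
    rcases List.mem_cons.1 (h2.mem_iff.1 hd) with rfl | hd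
    · simpa using hp
    · simpa using hM ((mem_sort _).1 hd)

/-- The quantized Plücker-type relation with quadruples:
`[Xik][Xjl] = q⁻¹[Xij][Xkl] + q[Xil][Xjk]`. -/
theorem flag_quadruple_identity
    {K A : Type} [Field K] [Ring A] [Algebra K A] {m n : ℕ}
    (q : K) (hq : q ≠ 0) (x : ℕ → ℕ → A) (hx : IsQMatrix q m n x)
    (i j k l : ℕ) (h1i : 1 ≤ i) (hij : i < j) (hjk : j < k) (hkl : k < l) (hln : l ≤ n)
    (X : Finset ℕ) (hXn : X ⊆ Finset.Icc 1 n)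
    (hiX : i ∉ X) (hjX : j ∉ X) (hkX : k ∉ X) (hlX : l ∉ X)
    (hm : X.card + 2 ≤ m) :
    flagMinor q x (insert i (insert k X)) * flagMinor q x (insert j (insert l X)) =
      q⁻¹ • (flagMinor q x (insert i (insert j X)) * flagMinor q x (insert k (insert l X))) +
        q • (flagMinor q x (insert i (insert l X)) * flagMinor q x (insert j (insert k X))) := by
  have hXi : insert i X ⊆ Icc 1 n := insert_subset (by simp; omega) hXn
  have hL : insert j (insert k (insert l X)) ⊆ Icc 1 n :=
    insert_subset (by simp; omega) (insert_subset (by simp; omega)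
      (insert_subset (by simp; omega) hXn))
  have hcard : #(insert i X) + 1 = #X + 2 := by rw [card_insert_of_notMem hiX]
  have hC : ∀ p ∈ Icc 1 n, p ∉ X → i < p →
      colMinor q x (List.range' 1 (#X + 2)).toFinset (p :: (insert i X).sort (· ≥ ·)) =
        (-q) ^ #{d ∈ X | p < d} • flagMinor q x (insert i (insert p X)) := by
    intro p hp hpX hip
    have hpi : p ∉ insert i X := by simp [hpX, hip.ne']
    rw [← hcard, hx.colMinor_cons_eq_flagMinor hq hXi hp hpi (by omega), filter_insert,
      if_neg hip.not_gt, insert_comm]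
  have hN : ∀ p, p ∉ X → #{d ∈ X | d < p} + #{d ∈ X | p < d} = #X := by
    intro p hp
    rw [← card_filter_add_card_filter_not (s := X) (· < p)]
    congr 2
    refine filter_congr fun d hd => ?_
    have : d ≠ p := fun h => hp (h ▸ hd)
    omega
  have hterm : ∀ p a b, p ∈ Icc 1 n → p ∉ X → i < p → a ∉ X → b ∉ X → a ≠ b → p ≠ a → p ≠ b →
      (-q) ^ #{d ∈ insert p (insert a (insert b X)) | d < p} •
        (colMinor q x (List.range' 1 (#X + 2)).toFinset (p :: (insert i X).sort (· ≥ ·)) *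
          rowMinor q x (List.range' 1 (#X + 2)) ((insert p (insert a (insert b X))).erase p)) =
      (-q) ^ (#X + ((if a < p then 1 else 0) + if b < p then 1 else 0)) •
        (flagMinor q x (insert i (insert p X)) * flagMinor q x (insert a (insert b X))) := by
    intro p a b hp hpX hip ha hb hab hpa hpb
    have hcardL : #(insert a (insert b X)) = #X + 2 := by
      rw [card_insert_of_notMem (by simp [ha, hab]), card_insert_of_notMem hb]
    have hlt : #{d ∈ insert p (insert a (insert b X)) | d < p} =
        #{d ∈ X | d < p} + ((if a < p then 1 else 0) + if b < p then 1 else 0) := by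
      simp only [filter_insert, lt_irrefl, if_false]
      split_ifs <;> simp [ha, hb, hab]
    rw [hC p hp hpX hip, erase_insert (by simp [hpX, hpa, hpb]),
      ← flagMinor_eq_rowMinor q x hcardL, smul_mul_assoc, smul_smul, ← pow_add, hlt, ← hN p hpX]
    congr 2
    omega
  have key := hx.maninOn.sum_colMinor_mul_rowMinor hq (I := List.range' 1 (#X + 2))
    List.pairwise_lt_range' (fun a ha => by
      rw [List.mem_range'_1] at ha
      exact ⟨ha.1, by omega⟩) ((insert i X).sort (· ≥ ·))
    (L := insert j (insert k (insert l X))) fun c hc => by simpa using hL hc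
  have h0 : ∀ p ∈ X,
      colMinor q x (List.range' 1 (#X + 2)).toFinset (p :: (insert i X).sort (· ≥ ·)) = 0 := by
    intro p hp
    refine hx.maninOn.colMinor_cons_of_mem hq (by simpa using hXn hp)
      (insert i X).sortedGT_sort.pairwise (fun d hd => by simpa using hXi ((mem_sort _).1 hd))
      (by simp [hp]) fun a ha => ?_
    rw [List.mem_toFinset, List.mem_range'_1] at ha
    exact ⟨ha.1, by omega⟩
  have hjL : j ∉ insert k (insert l X) := by simp [hjX]; omega
  have hkL : k ∉ insert l X := by simp [hkX]; omega
  rw [sum_insert hjL, sum_insert hkL, sum_insert hlX,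
    sum_eq_zero (s := X) (fun p hp => by rw [h0 p hp, zero_mul, smul_zero]), add_zero,
    hterm j k l (hL (by simp)) hjX hij hkX hlX hkl.ne hjk.ne (hjk.trans hkl).ne,
    show insert j (insert k (insert l X)) = insert k (insert j (insert l X)) from insert_comm ..,
    hterm k j l (hL (by simp)) hkX (hij.trans hjk) hjX hlX (hjk.trans hkl).ne hjk.ne' hkl.ne,
    show insert k (insert j (insert l X)) = insert l (insert j (insert k X)) by
      ext; simp only [mem_insert]; tauto,
    hterm l j k (hL (by simp)) hlX (hij.trans (hjk.trans hkl)) hjX hkX hjk.ne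
      (hjk.trans hkl).ne' hkl.ne'] at key
  simp only [hjk, hkl, hjk.trans hkl, hjk.not_gt, hkl.not_gt, (hjk.trans hkl).not_gt, if_true,
    if_false, pow_add, mul_smul, ← smul_add] at key
  have key := (smul_eq_zero_iff_right (pow_ne_zero #X (neg_ne_zero.2 hq))).1 key
  have key := congrArg (q⁻¹ • ·) key
  simp only [smul_add, smul_smul, smul_zero] at key
  rw [← sub_eq_zero, ← neg_eq_zero, ← key]
  match_scalars <;> field_simp
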